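/- arXiv:math/0610965 — 10 statements merged into one kernel-verified Lean document; each statement's English description precedes it below -/
import Mathlib

section
/- For every g in the union G of the groups of w_i-th roots of unity, one has k_min(g^{-1}) = μ·γ(g^{-1}) + age(g), where μ = w_0 + ⋯ + w_n. (Equivalently, with σ(k) := k − μ·s(k), for 0 ≤ d ≤ #I(g) − 1 one has σ(k_min(g^{-1}) + d) = d + age(g), matching half the orbifold degree of the basis class η_g^d.) -/
/-- The number of fractions `ℓ / w` in `[0, 1)` lying below `x ≤ 1` is `⌈x * w⌉`. -/
theorem card_filter_range_div_lt {w : ℕ} (hw : 0 < w) {x : ℝ} (hx : x ≤ 1) :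
    ((Finset.range w).filter fun ℓ : ℕ => (ℓ : ℝ) / (w : ℝ) < x).card = ⌈x * w⌉₊ := by
  have hw' : (0 : ℝ) < w := Nat.cast_pos.mpr hw
  rw [← Finset.card_range ⌈x * w⌉₊]
  congr 1
  ext ℓ
  simp only [Finset.mem_filter, Finset.mem_range, div_lt_iff₀ hw', Nat.lt_ceil]
  refine and_iff_right_of_imp fun h => ?_
  have : (ℓ : ℝ) < w := h.trans_le (mul_le_of_le_one_left hw'.le hx)
  exact_mod_cast this

theorem ceil_eq_self_add_fract_neg (x : ℝ) : (⌈x⌉ : ℝ) = x + Int.fract (-x) := by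
  rw [Int.fract, Int.floor_neg]
  push_cast
  ring

/-- Arguments (as fractions of a full turn) of mutually inverse complex numbers on the unit circle
sum to an integer. -/
theorem exists_int_add_eq_of_exp_inv {x y : ℝ}
    (h : (Complex.exp (2 * (Real.pi : ℂ) * Complex.I * (x : ℂ)))⁻¹ =
      Complex.exp (2 * (Real.pi : ℂ) * Complex.I * (y : ℂ))) :
    ∃ m : ℤ, x + y = m := by
  have h1 : Complex.exp (2 * (Real.pi : ℂ) * Complex.I * ((x + y : ℝ) : ℂ)) = 1 := by
    rw [Complex.ofReal_add, mul_add, Complex.exp_add, ← h]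
    exact mul_inv_cancel₀ (Complex.exp_ne_zero _)
  obtain ⟨m, hm⟩ := Complex.exp_eq_one_iff.mp h1
  rw [mul_comm (m : ℂ)] at hm
  exact ⟨m, by exact_mod_cast mul_left_cancel₀ Complex.two_pi_I_ne_zero hm⟩


/-- For every `g ∈ G = ⋃ μ_{wᵢ}`, one has
`k_min(g⁻¹) = μ·γ(g⁻¹) + age(g)` where `μ = w₀ + ⋯ + wₙ` and
`age(g) = ∑ᵢ {γ(g)·wᵢ}` (sum of fractional parts). -/
theorem kmin_inv_eq_mu_gamma_add_age (n : ℕ) (w : Fin (n + 1) → ℕ) (hw : ∀ i, 0 < w i)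
    (g : ℂ) (hg : ∃ i, g ^ (w i) = 1)
    (γ γ' : ℝ) (hγ0 : 0 ≤ γ) (hγ1 : γ < 1) (hγ'0 : 0 ≤ γ') (hγ'1 : γ' < 1)
    (hgγ : g = Complex.exp (2 * (Real.pi : ℂ) * Complex.I * (γ : ℂ)))
    (hgγ' : g⁻¹ = Complex.exp (2 * (Real.pi : ℂ) * Complex.I * (γ' : ℂ))) :
    ((∑ i, ((Finset.range (w i)).filter fun ℓ : ℕ => (ℓ : ℝ) / (w i : ℝ) < γ').card : ℕ) : ℝ)
      = ((∑ i, w i : ℕ) : ℝ) * γ' + ∑ i, Int.fract (γ * (w i : ℝ)) := by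
  rw [hgγ] at hgγ'
  obtain ⟨m, hm⟩ := exists_int_add_eq_of_exp_inv hgγ'
  push_cast
  rw [Finset.sum_mul, ← Finset.sum_add_distrib]
  refine Finset.sum_congr rfl fun i _ => ?_
  have hfract : Int.fract (γ * (w i : ℝ)) = Int.fract (-(γ' * w i)) := by
    rw [Int.fract_eq_fract]
    refine ⟨m * w i, ?_⟩
    push_cast
    rw [← hm]
    ring
  rw [card_filter_range_div_lt (hw i) hγ'1.le, hfract, mul_comm (w i : ℝ) γ',
    ← ceil_eq_self_add_fract_neg]
  exact natCast_ceil_eq_intCast_ceil (by positivity)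
end

section
/- Let g, g' be in the union G of the groups of w_i-th roots of unity, and let d, d' be integers with 0 ≤ d ≤ #I(g) − 1 and 0 ≤ d' ≤ #I(g') − 1. Then k_min(g^{-1}) + d + k_min(g'^{-1}) + d' ≡ n (mod μ) if and only if g·g' = 1 and d + d' = #I(g) − 1. -/
theorem card_filter_div_lt_eq_ceil {w : ℕ} (hw : 0 < w) {α : ℝ} (hα0 : 0 ≤ α) (hα1 : α ≤ 1) :
    (((Finset.range w).filter fun ℓ : ℕ => (ℓ : ℝ) / (w : ℝ) < α).card : ℤ) = ⌈(w : ℝ) * α⌉ := by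
  have hw' : (0 : ℝ) < w := by exact_mod_cast hw
  have hle : ⌈(w : ℝ) * α⌉₊ ≤ w := Nat.ceil_le.2 (by nlinarith)
  have hset : ((Finset.range w).filter fun ℓ : ℕ => (ℓ : ℝ) / (w : ℝ) < α)
      = Finset.range ⌈(w : ℝ) * α⌉₊ := by
    ext ℓ
    rw [Finset.mem_filter, Finset.mem_range, Finset.mem_range, Nat.lt_ceil, div_lt_iff₀' hw']
    refine ⟨fun h => h.2, fun h => ⟨?_, h⟩⟩
    exact (Nat.lt_ceil.2 h).trans_le hle
  rw [hset, Finset.card_range, Int.natCast_ceil_eq_ceil (by positivity)]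

theorem floor_add_one_sub_ceil (x : ℝ) [Decidable (∃ k : ℤ, x = k)] :
    ⌊x⌋ + 1 - ⌈x⌉ = if ∃ k : ℤ, x = k then 1 else 0 := by
  split_ifs with h
  · obtain ⟨k, rfl⟩ := h
    simp
  · have h1 : (⌊x⌋ : ℝ) < x := lt_of_le_of_ne (Int.floor_le x) fun e => h ⟨⌊x⌋, e.symm⟩
    have h2 : ⌈x⌉ = ⌊x⌋ + 1 := by
      rw [Int.ceil_eq_iff]
      push_cast
      exact ⟨by linarith, (Int.lt_floor_add_one x).le⟩
    omega

theorem pow_eq_one_iff_of_inv_eq_exp {g : ℂ} {α : ℝ}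
    (h : g⁻¹ = Complex.exp (2 * (Real.pi : ℂ) * Complex.I * (α : ℂ))) (w : ℕ) :
    g ^ w = 1 ↔ ∃ k : ℤ, (w : ℝ) * α = k := by
  rw [← inv_eq_one, ← inv_pow, h, ← Complex.exp_nat_mul, Complex.exp_eq_one_iff]
  refine exists_congr fun k => ?_
  rw [show (w : ℂ) * (2 * (Real.pi : ℂ) * Complex.I * (α : ℂ))
    = ((w : ℂ) * α) * (2 * (Real.pi : ℂ) * Complex.I) by ring,
    mul_left_inj' Complex.two_pi_I_ne_zero]
  exact_mod_cast Iff.rfl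

theorem mul_eq_one_iff_of_inv_eq_exp {g g' : ℂ} {α β : ℝ}
    (h : g⁻¹ = Complex.exp (2 * (Real.pi : ℂ) * Complex.I * (α : ℂ)))
    (h' : g'⁻¹ = Complex.exp (2 * (Real.pi : ℂ) * Complex.I * (β : ℂ))) :
    g * g' = 1 ↔ ∃ m : ℤ, α + β = m := by
  have hmul : (g * g')⁻¹ = Complex.exp (2 * (Real.pi : ℂ) * Complex.I * ((α + β : ℝ) : ℂ)) := by
    rw [mul_inv, h, h', ← Complex.exp_add]
    push_cast
    ring_nf
  simpa using pow_eq_one_iff_of_inv_eq_exp hmul 1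

section CeilSum

variable {ι : Type*} [Fintype ι] (w : ι → ℕ)

theorem sum_ceil_int_sub (m : ℤ) (α : ℝ) :
    ∑ i, ⌈(w i : ℝ) * (m - α)⌉ = m * ∑ i, (w i : ℤ) - ∑ i, ⌊(w i : ℝ) * α⌋ := by
  rw [Finset.mul_sum, ← Finset.sum_sub_distrib]
  refine Finset.sum_congr rfl fun i _ => ?_
  rw [show (w i : ℝ) * (m - α) = -(w i * α) + ((m * w i : ℤ) : ℝ) by push_cast; ring,
    Int.ceil_add_intCast, Int.ceil_neg]
  ring

theorem sum_floor_add_card_le_sum_ceil (hw : ∀ i, 0 < w i) {α β : ℝ} (h : α < β) :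
    ∑ i, ⌊(w i : ℝ) * α⌋ + Fintype.card ι ≤ ∑ i, ⌈(w i : ℝ) * β⌉ := by
  have : ∑ i, (⌊(w i : ℝ) * α⌋ + 1) ≤ ∑ i, ⌈(w i : ℝ) * β⌉ := by
    refine Finset.sum_le_sum fun i _ => ?_
    have hi : (0 : ℝ) < w i := by exact_mod_cast hw i
    rw [Int.add_one_le_iff, Int.lt_ceil]
    exact (Int.floor_le _).trans_lt (mul_lt_mul_of_pos_left h hi)
  simpa [Finset.sum_add_distrib] using this

theorem sum_ceil_add_card_filter_pow_eq_one {g : ℂ} {α : ℝ}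
    (h : g⁻¹ = Complex.exp (2 * (Real.pi : ℂ) * Complex.I * (α : ℂ)))
    [DecidablePred fun i => g ^ (w i) = 1] :
    ∑ i, ⌈(w i : ℝ) * α⌉ + (Finset.univ.filter fun i => g ^ (w i) = 1).card
      = ∑ i, ⌊(w i : ℝ) * α⌋ + Fintype.card ι := by
  classical
  have key : ∑ i, (⌊(w i : ℝ) * α⌋ + 1 - ⌈(w i : ℝ) * α⌉)
      = ((Finset.univ.filter fun i => g ^ (w i) = 1).card : ℤ) := by
    simp only [floor_add_one_sub_ceil, ← pow_eq_one_iff_of_inv_eq_exp h, Finset.sum_boole]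
  rw [← key, Finset.sum_sub_distrib, Finset.sum_add_distrib]
  simp

end CeilSum


/-- For `g, g' ∈ G` and `0 ≤ d ≤ #I(g) − 1`, `0 ≤ d' ≤ #I(g') − 1`:
`k_min(g⁻¹) + d + k_min(g'⁻¹) + d' ≡ n (mod μ)` iff `g·g' = 1` and `d + d' = #I(g) − 1`. -/
theorem kmin_add_congr_iff (n : ℕ) (w : Fin (n + 1) → ℕ) (hw : ∀ i, 0 < w i)
    (g g' : ℂ) (hg : ∃ i, g ^ (w i) = 1) (hg' : ∃ i, g' ^ (w i) = 1)
    (α β : ℝ) (hα0 : 0 ≤ α) (hα1 : α < 1) (hβ0 : 0 ≤ β) (hβ1 : β < 1)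
    (hgα : g⁻¹ = Complex.exp (2 * (Real.pi : ℂ) * Complex.I * (α : ℂ)))
    (hg'β : g'⁻¹ = Complex.exp (2 * (Real.pi : ℂ) * Complex.I * (β : ℂ)))
    (d d' : ℕ)
    (hd : d < (Finset.univ.filter fun i => g ^ (w i) = 1).card)
    (hd' : d' < (Finset.univ.filter fun i => g' ^ (w i) = 1).card) :
    ((∑ i, ((Finset.range (w i)).filter fun ℓ : ℕ => (ℓ : ℝ) / (w i : ℝ) < α).card) + d
        + (∑ i, ((Finset.range (w i)).filter fun ℓ : ℕ => (ℓ : ℝ) / (w i : ℝ) < β).card) + d')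
        ≡ n [MOD ∑ i, w i]
      ↔ g * g' = 1 ∧ d + d' = (Finset.univ.filter fun i => g ^ (w i) = 1).card - 1 := by
  have hKα := sum_ceil_add_card_filter_pow_eq_one w hgα
  have hKβ := sum_ceil_add_card_filter_pow_eq_one w hg'β
  rw [Fintype.card_fin] at hKα hKβ
  rw [mul_eq_one_iff_of_inv_eq_exp hgα hg'β, ← Int.natCast_modEq_iff, Int.modEq_comm,
    Int.modEq_iff_add_fac]
  push_cast
  simp only [card_filter_div_lt_eq_ceil (hw _) hα0 hα1.le,
    card_filter_div_lt_eq_ceil (hw _) hβ0 hβ1.le]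
  push_cast at hKα hKβ
  constructor
  · rintro ⟨m, hm⟩
    have hrefl := sum_ceil_int_sub w m α
    have hrefl' := sum_ceil_int_sub w m (m - α)
    rw [sub_sub_cancel] at hrefl'
    rw [mul_comm m] at hrefl hrefl'
    have hβ : β = m - α := by
      rcases lt_trichotomy β (m - α) with hlt | heq | hgt
      · have := sum_floor_add_card_le_sum_ceil w hw hlt
        rw [Fintype.card_fin] at this
        push_cast at this
        omega
      · exact heq
      · have := sum_floor_add_card_le_sum_ceil w hw hgt
        rw [Fintype.card_fin] at this
        push_cast at this
        omega
    refine ⟨⟨m, by rw [hβ]; ring⟩, ?_⟩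
    rw [← hβ] at hrefl
    omega
  · rintro ⟨⟨m, hm⟩, hdd⟩
    have hrefl := sum_ceil_int_sub w m α
    rw [← eq_sub_of_add_eq' hm, mul_comm m] at hrefl
    exact ⟨m, by omega⟩
end

section
/- The map (g, d) ↦ k_min(g) + d is a bijection from the set of pairs {(g, d) : g ∈ G, 0 ≤ d ≤ #I(g) − 1} onto {0, 1, …, μ − 1}, where μ = w_0 + ⋯ + w_n. (This is the combinatorial content of the fact that the linear map Ξ sending η_g^d to ω_{k_min(g^{-1})+d} is an isomorphism of μ-dimensional vector spaces.) -/
open Finset in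
/-- Listing a finite set in increasing order of a function `f`: the pairs `(t, d)` with `d` less than
the size of the fibre over `t` enumerate `{0, …, #S - 1}` via `(t, d) ↦ #{x ∈ S | f x < t} + d`. -/
theorem Finset.bijOn_card_filter_lt_add {α β : Type*} [LinearOrder β] (S : Finset α) (f : α → β) :
    Set.BijOn (fun p : β × ℕ => #{x ∈ S | f x < p.1} + p.2)
      {p : β × ℕ | p.2 < #{x ∈ S | f x = p.1}} {k : ℕ | k < #S} := by
  classical
  have card_le_eq (t : β) : #{x ∈ S | f x ≤ t} = #{x ∈ S | f x < t} + #{x ∈ S | f x = t} := by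
    rw [← card_union_of_disjoint, ← filter_or]
    · simp only [le_iff_lt_or_eq]
    · exact disjoint_filter.2 fun x _ h h' => h.ne h'
  have card_le_lt {s t : β} (h : s < t) : #{x ∈ S | f x ≤ s} ≤ #{x ∈ S | f x < t} :=
    card_le_card (monotone_filter_right _ fun x _ hx => lt_of_le_of_lt hx h)
  refine ⟨?_, ?_, ?_⟩
  · rintro ⟨t, d⟩ hd
    have := card_filter_le S (f · ≤ t)
    have := card_le_eq t
    simp only [Set.mem_ofPred_eq] at hd ⊢
    lia
  · rintro ⟨t, d⟩ hd ⟨t', d'⟩ hd' h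
    simp only [Set.mem_ofPred_eq] at hd hd' h
    have h₁ := card_le_eq t
    have h₂ := card_le_eq t'
    rcases lt_trichotomy t t' with hlt | rfl | hlt
    · have := card_le_lt hlt
      lia
    · simpa using h
    · have := card_le_lt hlt
      lia
  · intro k hk
    simp only [Set.mem_ofPred_eq] at hk
    have hS : S.Nonempty := card_pos.1 (by lia)
    obtain ⟨m, hm, hmax⟩ := S.exists_max_image f hS
    have hne : ({x ∈ S | k < #{y ∈ S | f y ≤ f x}}).Nonempty := by
      refine ⟨m, mem_filter.2 ⟨hm, ?_⟩⟩
      rwa [filter_true_of_mem hmax]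
    obtain ⟨a, ha, hmin⟩ := exists_min_image _ f hne
    rw [mem_filter] at ha
    have hle : #{x ∈ S | f x < f a} ≤ k := by
      by_contra! hlt
      obtain ⟨b, hb, hbmax⟩ := exists_max_image {x ∈ S | f x < f a} f (card_pos.1 (by lia))
      rw [mem_filter] at hb
      refine (hmin b (mem_filter.2 ⟨hb.1, hlt.trans_le (card_le_card fun x hx => ?_)⟩)).not_gt hb.2
      exact mem_filter.2 ⟨(mem_filter.1 hx).1, hbmax x hx⟩
    have := card_le_eq (f a)
    refine ⟨(f a, k - #{x ∈ S | f x < f a}), ?_, ?_⟩ <;> simp only [Set.mem_ofPred_eq] <;> lia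

theorem Finset.card_filter_sigma {ι : Type*} {σ : ι → Type*} (s : Finset ι)
    (t : ∀ i, Finset (σ i)) (p : (Σ i, σ i) → Prop) [DecidablePred p] :
    ((s.sigma t).filter p).card = ∑ i ∈ s, ((t i).filter fun x => p ⟨i, x⟩).card := by
  simp only [Finset.card_filter, Finset.sum_sigma]

/-- For `t ∈ [0, 1)`, `exp (2πit)` is a `w`-th root of unity iff `t = ℓ / w` for some `ℓ < w`. -/
theorem Complex.exp_two_pi_mul_I_mul_pow_eq_one_iff {w : ℕ} (hw : 0 < w) {t : ℝ} (h0 : 0 ≤ t)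
    (h1 : t < 1) :
    Complex.exp (2 * (Real.pi : ℂ) * Complex.I * (t : ℂ)) ^ w = 1 ↔
      ∃ ℓ < w, (ℓ : ℝ) / (w : ℝ) = t := by
  have hw' : (0 : ℝ) < w := by exact_mod_cast hw
  rw [← Complex.exp_nat_mul, Complex.exp_eq_one_iff]
  have key (m : ℤ) : (w : ℂ) * (2 * (Real.pi : ℂ) * Complex.I * (t : ℂ)) =
      m * (2 * (Real.pi : ℂ) * Complex.I) ↔ (w : ℝ) * t = m := by
    rw [mul_left_comm, mul_comm (m : ℂ), mul_right_inj' Complex.two_pi_I_ne_zero]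
    exact_mod_cast Iff.rfl
  simp only [key]
  constructor
  · rintro ⟨m, hm⟩
    have hm0 : 0 ≤ m := by
      have : (0 : ℝ) ≤ m := hm ▸ by positivity
      exact_mod_cast this
    lift m to ℕ using hm0
    rw [Int.cast_natCast] at hm
    refine ⟨m, ?_, ?_⟩
    · have : (m : ℝ) < w := by nlinarith
      exact_mod_cast this
    · rw [← hm]
      field_simp
  · rintro ⟨ℓ, -, rfl⟩
    exact ⟨ℓ, by push_cast; field_simp⟩

theorem Complex.exp_two_pi_mul_I_mul_injOn_Ico :
    Set.InjOn (fun t : ℝ => Complex.exp (2 * (Real.pi : ℂ) * Complex.I * (t : ℂ)))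
      (Set.Ico 0 1) := by
  rintro s ⟨hs0, hs1⟩ t ⟨ht0, ht1⟩ h
  obtain ⟨m, hm⟩ := Complex.exp_eq_exp_iff_exists_int.1 h
  rw [mul_comm (m : ℂ), ← mul_add, mul_right_inj' Complex.two_pi_I_ne_zero] at hm
  have hm' : s = t + m := by exact_mod_cast hm
  have h₁ : (m : ℝ) < 1 := by linarith
  have h₂ : (-1 : ℝ) < m := by linarith
  have h₃ : m < 1 := by exact_mod_cast h₁
  have h₄ : -1 < m := by exact_mod_cast h₂
  obtain rfl : m = 0 := by lia
  simpa using hm'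

/-- For `t ∈ [0, 1)`, at most one `ℓ < w` satisfies `ℓ / w = t`, and one does iff `exp (2πit)` is a
`w`-th root of unity. -/
theorem card_filter_range_div_eq {w : ℕ} (hw : 0 < w) {t : ℝ} (h0 : 0 ≤ t) (h1 : t < 1) :
    ((Finset.range w).filter fun ℓ : ℕ => (ℓ : ℝ) / (w : ℝ) = t).card =
      if Complex.exp (2 * (Real.pi : ℂ) * Complex.I * (t : ℂ)) ^ w = 1 then 1 else 0 := by
  have hw' : (w : ℝ) ≠ 0 := by exact_mod_cast hw.ne'
  simp only [Complex.exp_two_pi_mul_I_mul_pow_eq_one_iff hw h0 h1]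
  split_ifs with h
  · obtain ⟨ℓ, hℓ, rfl⟩ := h
    refine Finset.card_eq_one.2 ⟨ℓ, ?_⟩
    ext k
    simp only [Finset.mem_filter, Finset.mem_range, Finset.mem_singleton, div_left_inj' hw',
      Nat.cast_inj]
    exact ⟨And.right, fun hk => ⟨hk ▸ hℓ, hk⟩⟩
  · rw [Finset.card_eq_zero, Finset.filter_eq_empty_iff]
    exact fun ℓ hℓ hℓt => h ⟨ℓ, Finset.mem_range.1 hℓ, hℓt⟩

/-- The map `(g, d) ↦ k_min(g) + d` is a bijection from
`{(g, d) : g ∈ G, 0 ≤ d ≤ #I(g) − 1}` onto `{0, 1, …, μ − 1}` where `μ = w₀ + ⋯ + wₙ`. -/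
theorem kmin_add_bijOn (n : ℕ) (w : Fin (n + 1) → ℕ) (hw : ∀ i, 0 < w i)
    (γ : ℂ → ℝ)
    (hγ : ∀ g : ℂ, (∃ i, g ^ (w i) = 1) →
      0 ≤ γ g ∧ γ g < 1 ∧ g = Complex.exp (2 * (Real.pi : ℂ) * Complex.I * ((γ g : ℝ) : ℂ))) :
    Set.BijOn
      (fun p : ℂ × ℕ =>
        (∑ i, ((Finset.range (w i)).filter fun ℓ : ℕ => (ℓ : ℝ) / (w i : ℝ) < γ p.1).card) + p.2)
      {p : ℂ × ℕ | (∃ i, p.1 ^ (w i) = 1)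
        ∧ p.2 < (Finset.univ.filter fun i => p.1 ^ (w i) = 1).card}
      {k : ℕ | k < ∑ i, w i} := by
  let S : Finset (Σ _ : Fin (n + 1), ℕ) := Finset.univ.sigma fun i => Finset.range (w i)
  let f : (Σ _ : Fin (n + 1), ℕ) → ℝ := fun x => (x.2 : ℝ) / (w x.1 : ℝ)
  have hfib {g : ℂ} (hg : ∃ i, g ^ (w i) = 1) :
      (S.filter fun x => f x = γ g).card = (Finset.univ.filter fun i => g ^ (w i) = 1).card := by
    obtain ⟨h0, h1, hexp⟩ := hγ g hg
    rw [Finset.card_filter_sigma, Finset.card_filter]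
    refine Finset.sum_congr rfl fun i _ => ?_
    rw [card_filter_range_div_eq (hw i) h0 h1, ← hexp]
  have harg : Set.BijOn (fun p : ℂ × ℕ => (γ p.1, p.2))
      {p : ℂ × ℕ | (∃ i, p.1 ^ (w i) = 1)
        ∧ p.2 < (Finset.univ.filter fun i => p.1 ^ (w i) = 1).card}
      {p : ℝ × ℕ | p.2 < (S.filter fun x => f x = p.1).card} := by
    refine ⟨?_, ?_, ?_⟩
    · rintro ⟨g, d⟩ ⟨hg, hd⟩
      simpa only [Set.mem_ofPred_eq, hfib hg] using hd
    · rintro ⟨g, d⟩ ⟨hg, -⟩ ⟨g', d'⟩ ⟨hg', -⟩ h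
      obtain ⟨hgg, rfl⟩ := Prod.mk.inj h
      refine Prod.ext ?_ rfl
      dsimp only at hg hg' hgg ⊢
      rw [(hγ g hg).2.2, (hγ g' hg').2.2, hgg]
    · rintro ⟨t, d⟩ hd
      simp only [Set.mem_ofPred_eq] at hd
      obtain ⟨⟨i, ℓ⟩, hx⟩ := Finset.card_pos.1 (Nat.zero_lt_of_lt hd)
      obtain ⟨hxS, hxt⟩ := Finset.mem_filter.1 hx
      have hℓ : ℓ < w i := Finset.mem_range.1 (Finset.mem_sigma.1 hxS).2
      replace hxt : (ℓ : ℝ) / (w i : ℝ) = t := hxt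
      have hwi : (0 : ℝ) < w i := by exact_mod_cast hw i
      have h0 : 0 ≤ t := hxt ▸ by positivity
      have h1 : t < 1 := by
        rw [← hxt, div_lt_one hwi]
        exact_mod_cast hℓ
      set g : ℂ := Complex.exp (2 * (Real.pi : ℂ) * Complex.I * (t : ℂ)) with hgdef
      have hg : ∃ i, g ^ (w i) = 1 :=
        ⟨i, (Complex.exp_two_pi_mul_I_mul_pow_eq_one_iff (hw i) h0 h1).2 ⟨ℓ, hℓ, hxt⟩⟩
      obtain ⟨hγ0, hγ1, hexp⟩ := hγ g hg
      have hgt : γ g = t :=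
        Complex.exp_two_pi_mul_I_mul_injOn_Ico ⟨hγ0, hγ1⟩ ⟨h0, h1⟩ (hexp.symm.trans hgdef)
      refine ⟨(g, d), ⟨hg, ?_⟩, Prod.ext hgt rfl⟩
      rw [← hfib hg, hgt]
      exact hd
  have hbij := (Finset.bijOn_card_filter_lt_add S f).comp harg
  have hS : S.card = ∑ i, w i := by simp [S]
  rw [hS] at hbij
  refine hbij.congr fun p _ => ?_
  simp only [Function.comp_apply, S, f, Finset.card_filter_sigma]
end

section
/- Let g < g' be two consecutive elements of G in the order given by γ (i.e. γ(g) < γ(g') and no element h ∈ G satisfies γ(g) < γ(h) < γ(g')). Then for every i ∈ {0,…,n}: ⌈w_i·γ(g)⌉ − ⌈w_i·γ(g')⌉ = −1 if i ∈ I(g), and ⌈w_i·γ(g)⌉ − ⌈w_i·γ(g')⌉ = 0 otherwise. -/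
/-- `exp (2πiβ)` is a `k`-th root of unity iff `kβ` is an integer. -/
theorem exp_two_pi_I_mul_pow_eq_one_iff (k : ℕ) (β : ℝ) :
    Complex.exp (2 * (Real.pi : ℂ) * Complex.I * (β : ℂ)) ^ k = 1 ↔ ∃ m : ℤ, (k : ℝ) * β = m := by
  rw [← Complex.exp_nat_mul, Complex.exp_eq_one_iff]
  refine exists_congr fun m => ?_
  rw [show (k : ℂ) * (2 * (Real.pi : ℂ) * Complex.I * (β : ℂ)) =
    ((k : ℂ) * β) * (2 * (Real.pi : ℂ) * Complex.I) by ring,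
    mul_left_inj' Complex.two_pi_I_ne_zero]
  exact_mod_cast Iff.rfl


/-- Let `g < g'` be two consecutive elements of `G` in the order given by `γ`.
Then for every `i`: `⌈wᵢ·γ(g)⌉ − ⌈wᵢ·γ(g')⌉ = −1` if `i ∈ I(g)`, and `= 0` otherwise. -/
theorem ceil_sub_ceil_consecutive (n : ℕ) (w : Fin (n + 1) → ℕ) (hw : ∀ i, 0 < w i)
    (g g' : ℂ) (hg : ∃ i, g ^ (w i) = 1) (hg' : ∃ i, g' ^ (w i) = 1)
    (γg γg' : ℝ) (hγg0 : 0 ≤ γg) (hγg1 : γg < 1) (hγg'0 : 0 ≤ γg') (hγg'1 : γg' < 1)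
    (hgγ : g = Complex.exp (2 * (Real.pi : ℂ) * Complex.I * (γg : ℂ)))
    (hg'γ : g' = Complex.exp (2 * (Real.pi : ℂ) * Complex.I * (γg' : ℂ)))
    (hlt : γg < γg')
    (hcons : ∀ h : ℂ, (∃ i, h ^ (w i) = 1) → ∀ β : ℝ, 0 ≤ β → β < 1 →
      h = Complex.exp (2 * (Real.pi : ℂ) * Complex.I * (β : ℂ)) → ¬(γg < β ∧ β < γg')) :
    ∀ i, ⌈(w i : ℝ) * γg⌉ - ⌈(w i : ℝ) * γg'⌉ = if g ^ (w i) = 1 then -1 else 0 := by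
  intro i
  have hwi : (0 : ℝ) < w i := by exact_mod_cast hw i
  have no_int_between : ∀ m : ℤ, (w i : ℝ) * γg < m → (w i : ℝ) * γg' ≤ m := by
    intro m hm
    by_contra! hm'
    have h₁ : γg < m / w i := by rwa [lt_div_iff₀' hwi]
    have h₂ : m / w i < γg' := by rwa [div_lt_iff₀' hwi]
    refine hcons _ ⟨i, (exp_two_pi_I_mul_pow_eq_one_iff (w i) (m / w i)).2 ⟨m, ?_⟩⟩ (m / w i)
      (hγg0.trans h₁.le) (h₂.trans hγg'1) (by push_cast; rfl) ⟨h₁, h₂⟩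
    field_simp
  have hmul : (w i : ℝ) * γg < w i * γg' := mul_lt_mul_of_pos_left hlt hwi
  rw [hgγ]
  split_ifs with h <;> rw [exp_two_pi_I_mul_pow_eq_one_iff] at h
  · obtain ⟨m, hm⟩ := h
    have hceil : ⌈(w i : ℝ) * γg'⌉ = m + 1 := by
      rw [Int.ceil_eq_iff]
      refine ⟨by push_cast; linarith, no_int_between (m + 1) (by push_cast; linarith)⟩
    rw [hceil, hm, Int.ceil_intCast]
    ring
  · have hlt_ceil : (w i : ℝ) * γg < ⌈(w i : ℝ) * γg⌉ :=
      (Int.le_ceil _).lt_of_ne fun heq => h ⟨_, heq⟩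
    have hle : ⌈(w i : ℝ) * γg'⌉ ≤ ⌈(w i : ℝ) * γg⌉ :=
      Int.ceil_le.2 (no_int_between _ hlt_ceil)
    rw [hle.antisymm (Int.ceil_mono hmul.le), sub_self]
end

section
/- Let g < g' be two consecutive elements of G in the order given by γ (i.e. γ(g) < γ(g') and no element h ∈ G satisfies γ(g) < γ(h) < γ(g')). Then k_min(g') = k_min(g) + #I(g). (In the paper's notation: k_min(g_{k−1}) + dim P(w)_{(g_{k−1})} + 1 = k_min(g_k).) -/
/-- For `β ∈ [0, 1)`, the number `exp (2πiβ)` is a `k`-th root of unity iff `β = ℓ / k` for some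
`ℓ < k`. -/
theorem exp_pow_eq_one_iff_exists_div {k : ℕ} (hk : 0 < k) {β : ℝ} (h0 : 0 ≤ β) (h1 : β < 1) :
    Complex.exp (2 * (Real.pi : ℂ) * Complex.I * (β : ℂ)) ^ k = 1 ↔
      ∃ l ∈ Finset.range k, (l : ℝ) / (k : ℝ) = β := by
  have hk' : (0 : ℝ) < k := by exact_mod_cast hk
  rw [← Complex.exp_nat_mul, Complex.exp_eq_one_iff]
  constructor
  · rintro ⟨m, hm⟩
    have hm' : (k : ℝ) * β = m := by
      have h : ((k : ℂ) * β) * (2 * Real.pi * Complex.I) = m * (2 * Real.pi * Complex.I) := by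
        rw [← hm]; ring
      exact_mod_cast mul_right_cancel₀ Complex.two_pi_I_ne_zero h
    have hm0 : 0 ≤ m := by
      have : (0 : ℝ) ≤ m := hm' ▸ by positivity
      exact_mod_cast this
    lift m to ℕ using hm0
    rw [Int.cast_natCast] at hm'
    refine ⟨m, Finset.mem_range.2 ?_, by rw [← hm']; field_simp⟩
    have : (m : ℝ) < k := by nlinarith
    exact_mod_cast this
  · rintro ⟨l, -, rfl⟩
    refine ⟨l, ?_⟩
    have : (k : ℂ) ≠ 0 := by exact_mod_cast hk.ne'
    push_cast
    field_simp

/-- If no `ℓ / k` with `ℓ < k` lies strictly between `a < b`, then passing from `a` to `b` increases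
the number of `ℓ / k` below the bound by one if `exp (2πia)` is a `k`-th root of unity, and by zero
otherwise. -/
theorem card_filter_div_lt_eq_add {k : ℕ} (hk : 0 < k) {a b : ℝ} (h0 : 0 ≤ a) (h1 : a < 1)
    (hab : a < b) (hgap : ∀ l ∈ Finset.range k, ¬(a < (l : ℝ) / k ∧ (l : ℝ) / k < b)) :
    ((Finset.range k).filter fun l : ℕ => (l : ℝ) / (k : ℝ) < b).card =
      ((Finset.range k).filter fun l : ℕ => (l : ℝ) / (k : ℝ) < a).card +
        if Complex.exp (2 * (Real.pi : ℂ) * Complex.I * (a : ℂ)) ^ k = 1 then 1 else 0 := by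
  have hk' : (k : ℝ) ≠ 0 := by exact_mod_cast hk.ne'
  have hsplit : ((Finset.range k).filter fun l : ℕ => (l : ℝ) / (k : ℝ) < b) =
      ((Finset.range k).filter fun l : ℕ => (l : ℝ) / (k : ℝ) < a) ∪
        ((Finset.range k).filter fun l : ℕ => (l : ℝ) / (k : ℝ) = a) := by
    rw [← Finset.filter_or]
    refine Finset.filter_congr fun l hl => ⟨fun h => ?_, ?_⟩
    · exact lt_or_eq_of_le (not_lt.1 fun h' => hgap l hl ⟨h', h⟩)
    · rintro (h | h)
      · exact h.trans hab
      · exact h.trans_lt hab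
  rw [hsplit, Finset.card_union_of_disjoint (Finset.disjoint_filter.2 fun _ _ h => h.ne)]
  congr 1
  split_ifs with h
  · obtain ⟨l, hl, hla⟩ := (exp_pow_eq_one_iff_exists_div hk h0 h1).1 h
    refine Finset.card_eq_one.2 ⟨l, Finset.eq_singleton_iff_unique_mem.2
      ⟨Finset.mem_filter.2 ⟨hl, hla⟩, fun m hm => ?_⟩⟩
    exact_mod_cast (div_left_inj' hk').1 ((Finset.mem_filter.1 hm).2.trans hla.symm)
  · exact Finset.card_eq_zero.2 (Finset.filter_eq_empty_iff.2 fun l hl hla =>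
      h ((exp_pow_eq_one_iff_exists_div hk h0 h1).2 ⟨l, hl, hla⟩))


/-- Let `g < g'` be two consecutive elements of `G` in the order given by `γ`.
Then `k_min(g') = k_min(g) + #I(g)`. -/
theorem kmin_consecutive (n : ℕ) (w : Fin (n + 1) → ℕ) (hw : ∀ i, 0 < w i)
    (g g' : ℂ) (hg : ∃ i, g ^ (w i) = 1) (hg' : ∃ i, g' ^ (w i) = 1)
    (γg γg' : ℝ) (hγg0 : 0 ≤ γg) (hγg1 : γg < 1) (hγg'0 : 0 ≤ γg') (hγg'1 : γg' < 1)
    (hgγ : g = Complex.exp (2 * (Real.pi : ℂ) * Complex.I * (γg : ℂ)))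
    (hg'γ : g' = Complex.exp (2 * (Real.pi : ℂ) * Complex.I * (γg' : ℂ)))
    (hlt : γg < γg')
    (hcons : ∀ h : ℂ, (∃ i, h ^ (w i) = 1) → ∀ β : ℝ, 0 ≤ β → β < 1 →
      h = Complex.exp (2 * (Real.pi : ℂ) * Complex.I * (β : ℂ)) → ¬(γg < β ∧ β < γg')) :
    (∑ i, ((Finset.range (w i)).filter fun ℓ : ℕ => (ℓ : ℝ) / (w i : ℝ) < γg').card)
      = (∑ i, ((Finset.range (w i)).filter fun ℓ : ℕ => (ℓ : ℝ) / (w i : ℝ) < γg).card)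
        + (Finset.univ.filter fun i => g ^ (w i) = 1).card := by
  subst hgγ
  rw [Finset.card_filter, ← Finset.sum_add_distrib]
  refine Finset.sum_congr rfl fun i _ => ?_
  refine card_filter_div_lt_eq_add (hw i) hγg0 hγg1 hlt fun l hl hbetween => ?_
  have hl0 : (0 : ℝ) ≤ (l : ℝ) / w i := by positivity
  have hl1 : (l : ℝ) / w i < 1 := hbetween.2.trans hγg'1
  exact hcons _ ⟨i, (exp_pow_eq_one_iff_exists_div (hw i) hl0 hl1).2 ⟨l, hl, rfl⟩⟩ _ hl0 hl1 rfl
    hbetween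
end

section
/- For every g ∈ G with γ(g) > 0, the falling-factorial product ∏_{i=0}^n ∏_{m=0}^{⌈γ(g)w_i⌉ − 1} (γ(g)·w_i − m) equals (∏_{i=0}^n w_i^{⌈γ(g)w_i⌉}) · ∏_{h ∈ G, γ(h) < γ(g)} (γ(g) − γ(h))^{#I(h)}. (This is the identity s_k = ∏_i w_i^{−⌈γ(g_k)w_i⌉} for the structure constants s_k of the small quantum cohomology of P(w).) -/
theorem exp_two_pi_mul_I_mul_eq_one_iff (x : ℝ) :
    Complex.exp (2 * (Real.pi : ℂ) * Complex.I * (x : ℂ)) = 1 ↔ ∃ k : ℤ, x = k := by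
  have h0 : (2 * (Real.pi : ℂ) * Complex.I) ≠ 0 := Complex.two_pi_I_ne_zero
  rw [Complex.exp_eq_one_iff]
  refine exists_congr fun k => ?_
  rw [mul_comm (k : ℂ), mul_right_inj' h0]
  norm_cast

theorem eq_of_exp_two_pi_mul_I_mul_eq {x y : ℝ} (hx : 0 ≤ x) (hx1 : x < 1) (hy : 0 ≤ y)
    (hy1 : y < 1) (h : Complex.exp (2 * (Real.pi : ℂ) * Complex.I * (x : ℂ))
      = Complex.exp (2 * (Real.pi : ℂ) * Complex.I * (y : ℂ))) : x = y := by
  obtain ⟨k, hk⟩ := (exp_two_pi_mul_I_mul_eq_one_iff (x - y)).1 (by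
    rw [Complex.ofReal_sub, mul_sub, Complex.exp_sub, h, div_self (Complex.exp_ne_zero _)])
  have h1 : k < 1 := by
    have : (k : ℝ) < 1 := by linarith
    exact_mod_cast this
  have h2 : -1 < k := by
    have : (-1 : ℝ) < k := by linarith
    exact_mod_cast this
  obtain rfl : k = 0 := by omega
  simpa [sub_eq_zero] using hk

theorem exp_two_pi_mul_I_mul_pow_eq_one_iff (x : ℝ) (d : ℕ) :
    Complex.exp (2 * (Real.pi : ℂ) * Complex.I * (x : ℂ)) ^ d = 1 ↔ ∃ k : ℤ, x * d = k := by
  rw [← exp_two_pi_mul_I_mul_eq_one_iff, ← Complex.exp_nat_mul]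
  push_cast
  ring_nf

theorem mem_range_toNat_ceil {a : ℝ} {m : ℕ} :
    m ∈ Finset.range ⌈a⌉.toNat ↔ (m : ℝ) < a := by
  rw [Finset.mem_range, Int.lt_toNat, Int.lt_ceil, Int.cast_natCast]

/-- If `S` contains the `d`-th roots of unity and `γ` gives arguments in `[0, 1)`, the falling
factorial of `c * d` is a product over the `d`-th roots of unity of argument below `c`. -/
theorem prod_range_sub_eq_prod_roots {d : ℕ} (hd : 0 < d) (S : Finset ℂ)
    (hS : ∀ h : ℂ, h ^ d = 1 → h ∈ S) (γ : ℂ → ℝ)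
    (hγ : ∀ h ∈ S,
      0 ≤ γ h ∧ γ h < 1 ∧ h = Complex.exp (2 * (Real.pi : ℂ) * Complex.I * ((γ h : ℝ) : ℂ)))
    {c : ℝ} (hc : c < 1) :
    ∏ m ∈ Finset.range ⌈c * (d : ℝ)⌉.toNat, (c * (d : ℝ) - (m : ℝ))
      = (d : ℝ) ^ ⌈c * (d : ℝ)⌉.toNat
        * ∏ h ∈ S.filter (fun h => γ h < c), if h ^ d = 1 then c - γ h else 1 := by
  have hd' : (0 : ℝ) < d := by exact_mod_cast hd
  set e : ℕ → ℂ := fun m =>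
    Complex.exp (2 * (Real.pi : ℂ) * Complex.I * (((m / d : ℝ) : ℝ) : ℂ)) with he
  have he1 (m : ℕ) : e m ^ d = 1 :=
    (exp_two_pi_mul_I_mul_pow_eq_one_iff _ d).2 ⟨m, by field_simp; simp⟩
  have hlt {m : ℕ} (hm : m ∈ Finset.range ⌈c * (d : ℝ)⌉.toNat) : (m / d : ℝ) < c :=
    (div_lt_iff₀ hd').2 (mem_range_toNat_ceil.1 hm)
  have hγe {m : ℕ} (hm : m ∈ Finset.range ⌈c * (d : ℝ)⌉.toNat) : γ (e m) = m / d := by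
    obtain ⟨h0, h1, h2⟩ := hγ (e m) (hS _ (he1 m))
    exact eq_of_exp_two_pi_mul_I_mul_eq h0 h1 (by positivity) ((hlt hm).trans hc) h2.symm
  rw [← Finset.prod_filter, ← Finset.card_range ⌈c * (d : ℝ)⌉.toNat, ← Finset.prod_const,
    Finset.card_range]
  have hbij : ∏ m ∈ Finset.range ⌈c * (d : ℝ)⌉.toNat, (c - (m / d : ℝ))
      = ∏ h ∈ (S.filter fun h => γ h < c).filter (fun h => h ^ d = 1), (c - γ h) := by
    refine Finset.prod_bij (fun m _ => e m) ?_ ?_ ?_ ?_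
    · intro m hm
      simp only [Finset.mem_filter]
      exact ⟨⟨hS _ (he1 m), (hγe hm).trans_lt (hlt hm)⟩, he1 m⟩
    · intro m hm m' hm' h
      have := (hγe hm).symm.trans ((congrArg γ h).trans (hγe hm'))
      rw [div_left_inj' hd'.ne'] at this
      exact_mod_cast this
    · intro h hh
      simp only [Finset.mem_filter] at hh
      obtain ⟨⟨hhS, hlt'⟩, hpow⟩ := hh
      obtain ⟨h0, -, h2⟩ := hγ h hhS
      rw [h2, exp_two_pi_mul_I_mul_pow_eq_one_iff] at hpow
      obtain ⟨k, hk⟩ := hpow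
      have hk0 : 0 ≤ k := by
        have : (0 : ℝ) ≤ k := hk ▸ by positivity
        exact_mod_cast this
      lift k to ℕ using hk0
      rw [Int.cast_natCast] at hk
      refine ⟨k, mem_range_toNat_ceil.2 (hk ▸ mul_lt_mul_of_pos_right hlt' hd'), ?_⟩
      have hkd : (k / d : ℝ) = γ h := by rw [← hk, mul_div_cancel_right₀ _ hd'.ne']
      simp only [he]
      rw [hkd, ← h2]
    · intro m hm
      rw [hγe hm]
  rw [← hbij, ← Finset.prod_mul_distrib]
  refine Finset.prod_congr rfl fun m _ => ?_
  field_simp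

/-- For every `g ∈ G` with `γ(g) > 0`,
`∏ᵢ ∏_{m=0}^{⌈γ(g)wᵢ⌉−1} (γ(g)·wᵢ − m)
  = (∏ᵢ wᵢ^{⌈γ(g)wᵢ⌉}) · ∏_{h ∈ G, γ(h) < γ(g)} (γ(g) − γ(h))^{#I(h)}`. -/
theorem falling_factorial_prod_eq (n : ℕ) (w : Fin (n + 1) → ℕ) (hw : ∀ i, 0 < w i)
    (S : Finset ℂ) (hS : ∀ h : ℂ, h ∈ S ↔ ∃ i, h ^ (w i) = 1)
    (γ : ℂ → ℝ)
    (hγ : ∀ h ∈ S,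
      0 ≤ γ h ∧ γ h < 1 ∧ h = Complex.exp (2 * (Real.pi : ℂ) * Complex.I * ((γ h : ℝ) : ℂ)))
    (g : ℂ) (hg : g ∈ S) (hgpos : 0 < γ g) :
    (∏ i, ∏ m ∈ Finset.range (⌈γ g * (w i : ℝ)⌉.toNat), (γ g * (w i : ℝ) - (m : ℝ)))
      = (∏ i, (w i : ℝ) ^ (⌈γ g * (w i : ℝ)⌉.toNat))
        * ∏ h ∈ S.filter (fun h => γ h < γ g),
            (γ g - γ h) ^ (Finset.univ.filter fun i => h ^ (w i) = 1).card := by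
  rw [Finset.prod_congr rfl fun i _ => prod_range_sub_eq_prod_roots (hw i) S
    (fun h hh => (hS h).2 ⟨i, hh⟩) γ hγ (hγ g hg).2.1, Finset.prod_mul_distrib, Finset.prod_comm]
  congr 1
  refine Finset.prod_congr rfl fun h _ => ?_
  rw [← Finset.prod_filter, Finset.prod_const]
end

section
/- Let U := {u ∈ ℂ^{n+1} : ∏_{i=0}^n u_i^{w_i} = 1} (so that each u_i ≠ 0) and f : U → ℂ, f(u) = u_0 + ⋯ + u_n. Call u ∈ U a critical point of f|_U if the linear form v ↦ ∑_{i=0}^n v_i on ℂ^{n+1} vanishes on the hyperplane {v ∈ ℂ^{n+1} : ∑_{i=0}^n (w_i/u_i)·v_i = 0} (the kernel of the differential at u of u ↦ ∏ u_i^{w_i}). Then the set of critical values {f(u) : u ∈ U a critical point of f|_U} is exactly {c ∈ ℂ : c^μ · ∏_{i=0}^n w_i^{w_i} = μ^μ}, where μ = w_0 + ⋯ + w_n; in particular f|_U has exactly μ distinct critical values, namely μ·ζ·(∏_i w_i^{w_i})^{−1/μ} for ζ ranging over the μ-th roots of unity. -/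
/-- If a linear form with nonzero coefficients `a` has its kernel inside that of the coordinate sum,
then all its coefficients are equal. -/
theorem inv_coeff_eq_of_ker_le_ker_sum {ι K : Type*} [Fintype ι] [DecidableEq ι] [Field K]
    {a : ι → K} (ha : ∀ i, a i ≠ 0)
    (h : ∀ v : ι → K, ∑ i, a i * v i = 0 → ∑ i, v i = 0) (i j : ι) :
    (a i)⁻¹ = (a j)⁻¹ := by
  have key := h (Pi.single i (a i)⁻¹ - Pi.single j (a j)⁻¹) (by
    simp [mul_sub, Finset.sum_sub_distrib, Pi.single_apply, ha])
  simpa [Finset.sum_sub_distrib, sub_eq_zero] using key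

/-- The set of critical values of `f(u) = u₀ + ⋯ + uₙ` restricted to
`U = {u : ∏ uᵢ^{wᵢ} = 1}` (a point `u ∈ U` being critical when the linear form
`v ↦ ∑ vᵢ` vanishes on the kernel of `v ↦ ∑ (wᵢ/uᵢ)·vᵢ`) is exactly
`{c : c^μ · ∏ wᵢ^{wᵢ} = μ^μ}`, where `μ = w₀ + ⋯ + wₙ`. -/
theorem critical_values_of_f (n : ℕ) (w : Fin (n + 1) → ℕ) (hw : ∀ i, 0 < w i) :
    {c : ℂ | ∃ u : Fin (n + 1) → ℂ, (∏ i, u i ^ (w i)) = 1 ∧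
        (∀ v : Fin (n + 1) → ℂ, (∑ i, (w i : ℂ) / u i * v i) = 0 → (∑ i, v i) = 0) ∧
        c = ∑ i, u i}
      = {c : ℂ | c ^ (∑ i, w i) * (∏ i, (w i : ℂ) ^ (w i))
          = ((∑ i, w i : ℕ) : ℂ) ^ (∑ i, w i)} := by
  have hw' : ∀ i, (w i : ℂ) ≠ 0 := fun i => Nat.cast_ne_zero.mpr (hw i).ne'
  have hμ : ((∑ i, w i : ℕ) : ℂ) ≠ 0 :=
    Nat.cast_ne_zero.mpr (Finset.sum_pos (fun i _ => hw i) Finset.univ_nonempty).ne'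
  have hprod : ∀ t : ℂ, ∏ i, (t * w i) ^ w i = t ^ (∑ i, w i) * ∏ i, (w i : ℂ) ^ w i := fun t => by
    simp [mul_pow, Finset.prod_mul_distrib, Finset.prod_pow_eq_pow_sum]
  have hsum : ∀ t : ℂ, ∑ i, t * w i = t * ((∑ i, w i : ℕ) : ℂ) := fun t => by
    rw [← Finset.mul_sum, Nat.cast_sum]
  ext c
  constructor
  · rintro ⟨u, hu, hcrit, rfl⟩
    have hu0 : ∀ i, u i ≠ 0 := fun i hi => by
      rw [Finset.prod_eq_zero (Finset.mem_univ i) (by rw [hi, zero_pow (hw i).ne'])] at hu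
      exact zero_ne_one hu
    obtain ⟨t, rfl⟩ : ∃ t : ℂ, u = fun i => t * w i := by
      refine ⟨u 0 / w 0, funext fun i => ?_⟩
      have h := inv_coeff_eq_of_ker_le_ker_sum
        (fun i => div_ne_zero (hw' i) (hu0 i)) hcrit i 0
      rw [inv_div, inv_div] at h
      rw [← h, div_mul_cancel₀ _ (hw' i)]
    rw [hprod] at hu
    rw [Set.mem_ofPred_eq, hsum, mul_pow, mul_right_comm, hu, one_mul]
  · intro hc
    rw [Set.mem_ofPred_eq] at hc
    have ht : (c / ((∑ i, w i : ℕ) : ℂ)) ^ (∑ i, w i) * ∏ i, (w i : ℂ) ^ w i = 1 := by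
      rw [div_pow, div_mul_eq_mul_div, hc, div_self (pow_ne_zero _ hμ)]
    have ht0 : c / ((∑ i, w i : ℕ) : ℂ) ≠ 0 := fun h0 => by
      rw [h0, zero_pow (Nat.cast_ne_zero.mp hμ), zero_mul] at ht
      exact zero_ne_one ht
    refine ⟨fun i => c / ((∑ i, w i : ℕ) : ℂ) * w i, (hprod _).trans ht, fun v hv => ?_, ?_⟩
    · simp_rw [div_mul_cancel_right₀ (hw' _), ← Finset.mul_sum] at hv
      exact (mul_eq_zero.mp hv).resolve_left (inv_ne_zero ht0)
    · rw [hsum, div_mul_cancel₀ _ hμ]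
end

section
/- Let A° be the μ×μ complex matrix with entries indexed by ℤ/μℤ given by: A°_{j+1, j} = μ if s(j+1) = s(j), A°_{j+1, j} = μ·∏_{i ∈ I(s(j))} w_i^{−1} if s(j+1) ≠ s(j) (indices j+1 taken mod μ), and all other entries zero. Then the characteristic polynomial of A° is X^μ − μ^μ·∏_{i=0}^n w_i^{−w_i}; in particular A° has μ distinct nonzero eigenvalues (the critical values of the Laurent polynomial f), hence is a regular semisimple matrix. -/
open Polynomial in
/-- The characteristic polynomial of a weighted cyclic shift with nonzero weights `a j`
is `X ^ N - ∏ j, a j`. -/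
theorem Matrix.charpoly_weighted_cyclic_shift {R : Type*} [CommRing R] [IsDomain R] {N : ℕ}
    (hN : 0 < N) (A : Matrix (Fin N) (Fin N) R) (a : Fin N → R) (ha : ∀ j, a j ≠ 0)
    (hA : ∀ i j : Fin N, A i j = if (i : ℕ) = ((j : ℕ) + 1) % N then a j else 0) :
    A.charpoly = X ^ N - C (∏ j, a j) := by
  let b : ℕ → R := fun l => a ⟨l % N, Nat.mod_lt _ hN⟩
  have hb : ∀ l, b l ≠ 0 := fun l => ha _
  have hpow : ∀ (m : ℕ) (i : Fin N), (A ^ m) i ⟨0, hN⟩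
      = if (i : ℕ) = m % N then ∏ l ∈ Finset.range m, b l else 0 := by
    intro m
    induction m with
    | zero => intro i; by_cases hi : (i : ℕ) = 0 <;> simp [Matrix.one_apply, Fin.ext_iff, hi]
    | succ m ih =>
      intro i
      rw [pow_succ', Matrix.mul_apply, Finset.sum_eq_single ⟨m % N, Nat.mod_lt _ hN⟩]
      · rw [ih, hA, Finset.prod_range_succ]
        simp only [Nat.mod_add_mod, if_true, ite_mul, zero_mul]
        split_ifs
        · exact mul_comm _ _
        · rfl
      · intro j _ hj
        rw [ih, if_neg (fun h => hj (Fin.ext h)), mul_zero]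
      · simp
  have hprod : ∏ j, a j = ∏ l ∈ Finset.range N, b l := by
    rw [← Fin.prod_univ_eq_prod_range]
    refine Finset.prod_congr rfl fun j _ => ?_
    simp only [b, Nat.mod_eq_of_lt j.2]
  have hdeg : A.charpoly.natDegree = N := by simp
  have hlead : A.charpoly.coeff N = 1 := by
    have h := A.charpoly_monic.coeff_natDegree
    rwa [hdeg] at h
  have hCH : ∀ i : Fin N, ∑ m ∈ Finset.range (N + 1),
      A.charpoly.coeff m * (if (i : ℕ) = m % N then ∏ l ∈ Finset.range m, b l else 0) = 0 := by
    intro i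
    have h := congrFun (congrFun A.aeval_self_charpoly i) ⟨0, hN⟩
    rw [aeval_eq_sum_range, hdeg, Matrix.sum_apply] at h
    simpa only [Matrix.smul_apply, hpow, smul_eq_mul, Matrix.zero_apply] using h
  have hsum : ∀ i : Fin N, ∑ m ∈ Finset.range N,
      A.charpoly.coeff m * (if (i : ℕ) = m % N then ∏ l ∈ Finset.range m, b l else 0)
      = A.charpoly.coeff i * ∏ l ∈ Finset.range i, b l := by
    intro i
    rw [Finset.sum_eq_single (i : ℕ)]
    · rw [if_pos (Nat.mod_eq_of_lt i.2).symm]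
    · intro m hm hmi
      rw [Nat.mod_eq_of_lt (Finset.mem_range.1 hm), if_neg (Ne.symm hmi), mul_zero]
    · intro h
      exact absurd (Finset.mem_range.2 i.2) h
  ext m
  rw [coeff_sub, coeff_X_pow, coeff_C, hprod]
  rcases lt_trichotomy m N with hm | rfl | hm
  · have h := hCH ⟨m, hm⟩
    rw [Finset.sum_range_succ, hsum, hlead, Nat.mod_self, one_mul] at h
    rw [if_neg hm.ne]
    rcases Nat.eq_zero_or_pos m with rfl | hm0
    · simp only [if_true, Finset.range_zero, Finset.prod_empty, mul_one] at h
      rw [if_pos rfl, zero_sub]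
      exact eq_neg_of_add_eq_zero_left h
    · simp only [hm0.ne', if_false, add_zero] at h
      rw [if_neg hm0.ne', sub_zero]
      exact (mul_eq_zero.1 h).resolve_right (Finset.prod_ne_zero_iff.2 fun l _ => hb l)
  · rw [hlead, if_pos rfl, if_neg hN.ne', sub_zero]
  · rw [if_neg hm.ne', if_neg (hN.trans hm).ne', sub_zero]
    exact coeff_eq_zero_of_natDegree_lt (hdeg.trans_lt hm)

/-- For a monotone sequence that is not constant, the indices at which the value changes
cyclically pick out each value exactly once. -/
theorem Finset.prod_cyclic_jumps_eq_prod_image {α M : Type*} [LinearOrder α] [CommMonoid M]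
    {N : ℕ} (hN : 0 < N) (s : Fin N → α) (hs : Monotone s)
    (hne : s ⟨0, hN⟩ ≠ s ⟨N - 1, Nat.sub_lt hN one_pos⟩) (g : α → M) :
    ∏ j ∈ Finset.univ.filter
        (fun j : Fin N => s ⟨((j : ℕ) + 1) % N, Nat.mod_lt _ hN⟩ ≠ s j), g (s j)
      = ∏ q ∈ Finset.univ.image s, g q := by
  have hlt : ∀ i j : Fin N, i < j → s ⟨((i : ℕ) + 1) % N, Nat.mod_lt _ hN⟩ ≠ s i → s i ≠ s j := by
    intro i j hij hi h
    have hij' : (i : ℕ) + 1 ≤ j := hij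
    have hmod : ((i : ℕ) + 1) % N = i + 1 := Nat.mod_eq_of_lt (hij'.trans_lt j.2)
    refine hi (le_antisymm ((hs ?_).trans h.ge) (hs ?_))
    · rw [Fin.le_def]; simpa only [hmod] using hij'
    · rw [Fin.le_def]; simp only [hmod]; omega
  refine Finset.prod_bij (fun j _ => s j) ?_ ?_ ?_ (fun _ _ => rfl)
  · intro j _
    exact Finset.mem_image_of_mem _ (Finset.mem_univ _)
  · intro i hi j hj h
    simp only [Finset.mem_filter, Finset.mem_univ, true_and] at hi hj
    rcases lt_trichotomy i j with hij | hij | hij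
    · exact absurd h (hlt i j hij hi)
    · exact hij
    · exact absurd h.symm (hlt j i hij hj)
  · intro q hq
    obtain ⟨k, -, hk⟩ := Finset.mem_image.1 hq
    obtain ⟨j, hj, hmax⟩ := (Finset.univ.filter (fun j => s j = q)).exists_max_image id
      ⟨k, by simp [hk]⟩
    simp only [Finset.mem_filter, Finset.mem_univ, true_and, id] at hj hmax
    refine ⟨j, ?_, hj⟩
    simp only [Finset.mem_filter, Finset.mem_univ, true_and]
    intro h
    rcases Nat.lt_or_ge ((j : ℕ) + 1) N with hlt' | hge
    · have h2 := hmax _ (h.trans hj)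
      rw [Fin.le_def] at h2
      simp only [Nat.mod_eq_of_lt hlt'] at h2
      omega
    · have hjN : (j : ℕ) + 1 = N := by omega
      have hj' : j = ⟨N - 1, Nat.sub_lt hN one_pos⟩ := Fin.ext (by simp only; omega)
      refine hne ?_
      rw [← hj', ← h]
      simp only [hjN, Nat.mod_self]

/-- A weight `m` whose fractions `ℓ / m` all belong to `S ⊆ [0, 1)` satisfies `m * q ∈ ℤ` for
exactly `m` elements `q` of `S`. -/
theorem card_filter_mul_den_eq_one (S : Finset ℚ) (hS : ∀ q ∈ S, 0 ≤ q ∧ q < 1) {m : ℕ}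
    (hm : 0 < m) (hmem : ∀ ℓ < m, (ℓ : ℚ) / m ∈ S) :
    (S.filter (fun q => ((m : ℚ) * q).den = 1)).card = m := by
  have hm' : (0 : ℚ) < m := by exact_mod_cast hm
  have himage : S.filter (fun q => ((m : ℚ) * q).den = 1)
      = (Finset.range m).image (fun ℓ : ℕ => (ℓ : ℚ) / m) := by
    ext q
    simp only [Finset.mem_filter, Finset.mem_image, Finset.mem_range]
    constructor
    · rintro ⟨hq, hden⟩
      obtain ⟨h0, h1⟩ := hS q hq
      have hnum : (((m : ℚ) * q).num : ℚ) = m * q := Rat.den_eq_one_iff _ |>.1 hden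
      have hnn : 0 ≤ ((m : ℚ) * q).num := Rat.num_nonneg.2 (mul_nonneg hm'.le h0)
      obtain ⟨ℓ, hℓ⟩ := Int.eq_ofNat_of_zero_le hnn
      rw [hℓ, Int.cast_natCast] at hnum
      refine ⟨ℓ, ?_, by rw [hnum]; field_simp⟩
      have : (ℓ : ℚ) < m := by rw [hnum]; nlinarith
      exact_mod_cast this
    · rintro ⟨ℓ, hℓ, rfl⟩
      refine ⟨hmem ℓ hℓ, ?_⟩
      rw [mul_div_cancel₀ _ hm'.ne']
      exact Rat.den_natCast _
  rw [himage, Finset.card_image_of_injective, Finset.card_range]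
  intro x y hxy
  have : (x : ℚ) = y := (div_left_inj' hm'.ne').1 hxy
  exact_mod_cast this


/-- Let `A°` be the `μ×μ` matrix with `A°_{j+1,j} = μ` if `s(j+1) = s(j)`,
`A°_{j+1,j} = μ·∏_{i ∈ I(s(j))} wᵢ⁻¹` otherwise (indices mod `μ`), all other entries `0`.
Then the characteristic polynomial of `A°` is `X^μ − μ^μ·∏ᵢ wᵢ^{−wᵢ}`. -/
theorem charpoly_A_circ (n : ℕ) (w : Fin (n + 1) → ℕ) (hw : ∀ i, 0 < w i)
    (s : Fin (∑ i, w i) → ℚ) (hs_mono : Monotone s)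
    (hs_enum : Finset.univ.val.map s
      = (Finset.univ.val : Multiset (Fin (n + 1))).bind
          (fun i => (Multiset.range (w i)).map fun ℓ => (ℓ : ℚ) / (w i : ℚ)))
    (A : Matrix (Fin (∑ i, w i)) (Fin (∑ i, w i)) ℂ)
    (hA : ∀ j' j : Fin (∑ i, w i), A j' j =
      if (j' : ℕ) = ((j : ℕ) + 1) % (∑ i, w i) then
        (if s j' = s j then ((∑ i, w i : ℕ) : ℂ)
         else ((∑ i, w i : ℕ) : ℂ)
            * ∏ i ∈ Finset.univ.filter (fun i => ((w i : ℚ) * s j).den = 1), ((w i : ℂ))⁻¹)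
      else 0) :
    A.charpoly = Polynomial.X ^ (∑ i, w i)
      - Polynomial.C (((∑ i, w i : ℕ) : ℂ) ^ (∑ i, w i) * ∏ i, ((w i : ℂ))⁻¹ ^ (w i)) := by
  have hN : 0 < ∑ i, w i := Finset.sum_pos (fun i _ => hw i) Finset.univ_nonempty
  have hwC : ∀ i, (w i : ℂ) ≠ 0 := fun i => Nat.cast_ne_zero.2 (hw i).ne'
  have hmem : ∀ q, (∃ j, s j = q) ↔ ∃ i, ∃ ℓ < w i, (ℓ : ℚ) / w i = q := by
    intro q
    have h := congrArg (q ∈ ·) hs_enum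
    simpa using h
  have hrange : ∀ j, 0 ≤ s j ∧ s j < 1 := by
    intro j
    obtain ⟨i, ℓ, hℓ, h⟩ := (hmem (s j)).1 ⟨j, rfl⟩
    have hi : (0 : ℚ) < w i := by exact_mod_cast hw i
    rw [← h, div_lt_one hi]
    exact ⟨by positivity, by exact_mod_cast hℓ⟩
  generalize ∑ i, w i = N at *
  have hNC : (N : ℂ) ≠ 0 := Nat.cast_ne_zero.2 hN.ne'
  let g : ℚ → ℂ := fun q => ∏ i ∈ Finset.univ.filter (fun i => ((w i : ℚ) * q).den = 1),
    ((w i : ℂ))⁻¹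
  have hg : ∀ q, g q ≠ 0 := fun q => Finset.prod_ne_zero_iff.2 fun i _ => inv_ne_zero (hwC i)
  let next : Fin N → Fin N := fun j => ⟨((j : ℕ) + 1) % N, Nat.mod_lt _ hN⟩
  let c : Fin N → ℂ := fun j => if s (next j) ≠ s j then g (s j) else 1
  have hc : ∀ j, c j ≠ 0 := by
    intro j
    simp only [c]
    split_ifs
    · exact hg _
    · exact one_ne_zero
  rw [Matrix.charpoly_weighted_cyclic_shift hN A (fun j => N * c j)
    (fun j => mul_ne_zero hNC (hc j)), Finset.prod_mul_distrib, Finset.prod_const,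
    Finset.card_univ, Fintype.card_fin]
  · congr 3
    by_cases hconst : s ⟨0, hN⟩ = s ⟨N - 1, Nat.sub_lt hN one_pos⟩
    · have hall : ∀ j, s j = s ⟨0, hN⟩ := fun j => le_antisymm
        (hconst ▸ hs_mono (Fin.le_def.2 (Nat.le_sub_one_of_lt j.2)))
        (hs_mono (Fin.le_def.2 (Nat.zero_le _)))
      have hone : ∀ i, w i = 1 := by
        intro i
        by_contra hi
        have hi1 : 1 < w i := lt_of_le_of_ne (hw i) (Ne.symm hi)
        obtain ⟨j, hj⟩ := (hmem _).2 ⟨i, 0, hw i, rfl⟩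
        obtain ⟨k, hk⟩ := (hmem _).2 ⟨i, 1, hi1, rfl⟩
        have h : ((0 : ℕ) : ℚ) / w i = ((1 : ℕ) : ℚ) / w i := by
          rw [← hj, ← hk, hall j, hall k]
        simp only [Nat.cast_zero, zero_div, Nat.cast_one] at h
        exact (one_div_ne_zero (Nat.cast_ne_zero.2 (hw i).ne')) h.symm
      simp [c, g, hone]
    · rw [← Finset.prod_filter, Finset.prod_cyclic_jumps_eq_prod_image hN s hs_mono hconst g]
      simp only [g, Finset.prod_filter]
      rw [Finset.prod_comm]
      refine Finset.prod_congr rfl fun i _ => ?_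
      rw [← Finset.prod_filter, Finset.prod_const, card_filter_mul_den_eq_one _ _ (hw i)]
      · intro ℓ hℓ
        simpa using (hmem _).2 ⟨i, ℓ, hℓ, rfl⟩
      · intro q hq
        obtain ⟨j, -, rfl⟩ := Finset.mem_image.1 hq
        exact hrange j
  · intro i j
    rw [hA]
    by_cases hij : (i : ℕ) = ((j : ℕ) + 1) % N
    · have hi : i = next j := Fin.ext hij
      rw [if_pos hij, if_pos hij, hi]
      by_cases h : s (next j) = s j <;> simp [c, g, h]
    · rw [if_neg hij, if_neg hij]
end

section
/- Let j, k ∈ {0,…,μ−1} satisfy j + k ≡ n (mod μ). Then s(j) + s(k) ∈ ℤ (i.e. the roots of unity exp(2πi s(j)) and exp(2πi s(k)) are inverse to each other), the sets I(s(j)) and I(s(k)) coincide, and σ(j) + σ(k) = n. (This is the content of the relation A_∞ + A_∞* = n·id for A_∞ = diag(σ(0),…,σ(μ−1)) with respect to the pairing g on the B side.) -/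
/-- A downward closed predicate on `Fin N` holds exactly on the initial segment whose length is the
number of its solutions. -/
theorem Fin.iff_lt_card_filter_of_antitone {N : ℕ} (p : Fin N → Prop) [DecidablePred p]
    (hp : ∀ a b, a ≤ b → p b → p a) (j : Fin N) :
    p j ↔ (j : ℕ) < (Finset.univ.filter p).card := by
  constructor
  · intro hj
    have h : Finset.Iic j ⊆ Finset.univ.filter p := fun a ha => by
      simpa using hp a j (Finset.mem_Iic.mp ha) hj
    simpa [Nat.succ_le_iff] using Finset.card_le_card h
  · intro hlt
    by_contra hj
    have h : Finset.univ.filter p ⊆ Finset.Iio j := fun a ha => by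
      rw [Finset.mem_Iio]
      by_contra hja
      exact hj (hp j a (not_lt.mp hja) (by simpa using ha))
    have := Finset.card_le_card h
    rw [Fin.card_Iio] at this
    omega

/-- The number of `ℓ < w` with `ℓ < m` is `m` as soon as `m ≤ w`. -/
theorem Multiset.countP_lt_range {w m : ℕ} (h : m ≤ w) (p : ℕ → Prop) [DecidablePred p]
    (hp : ∀ ℓ < w, p ℓ ↔ ℓ < m) : (Multiset.range w).countP p = m := by
  have : (Finset.range w).filter p = Finset.range m := by
    ext ℓ
    simp only [Finset.mem_filter, Finset.mem_range]
    constructor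
    · rintro ⟨h1, h2⟩
      exact (hp ℓ h1).mp h2
    · intro h1
      exact ⟨by omega, (hp ℓ (by omega)).mpr h1⟩
  rw [Multiset.countP_eq_card_filter]
  exact (congrArg Finset.card this).trans (Finset.card_range m)

theorem countP_div_le {w : ℕ} (hw : 0 < w) {x : ℚ} (h0 : 0 ≤ x) (h1 : x < 1) :
    ((Multiset.range w).map fun ℓ : ℕ => (ℓ : ℚ) / (w : ℚ)).countP (· ≤ x) = ⌊(w : ℚ) * x⌋₊ + 1 := by
  have hw' : (0 : ℚ) < w := by exact_mod_cast hw
  have hm : ⌊(w : ℚ) * x⌋₊ < w := (Nat.floor_lt (by positivity)).mpr (by nlinarith)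
  rw [Multiset.countP_map, ← Multiset.countP_eq_card_filter (p := fun ℓ : ℕ => (ℓ : ℚ) / w ≤ x)]
  refine Multiset.countP_lt_range hm _ fun ℓ _ => ?_
  rw [div_le_iff₀ hw', Nat.lt_succ_iff, Nat.le_floor_iff (by positivity), mul_comm]

theorem countP_div_lt_one_sub {w : ℕ} (hw : 0 < w) {x : ℚ} (h0 : 0 ≤ x) :
    ((Multiset.range w).map fun ℓ : ℕ => (ℓ : ℚ) / (w : ℚ)).countP (· < 1 - x)
      = w - ⌊(w : ℚ) * x⌋₊ := by
  have hw' : (0 : ℚ) < w := by exact_mod_cast hw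
  rw [Multiset.countP_map, ← Multiset.countP_eq_card_filter (p := fun ℓ : ℕ => (ℓ : ℚ) / w < 1 - x)]
  refine Multiset.countP_lt_range (Nat.sub_le _ _) _ fun ℓ hℓ => ?_
  have : ℓ < w - ⌊(w : ℚ) * x⌋₊ ↔ ⌊(w : ℚ) * x⌋₊ < w - ℓ := by omega
  rw [this, Nat.floor_lt (by positivity), div_lt_iff₀ hw', Nat.cast_sub hℓ.le]
  constructor <;> intro h <;> linarith

theorem Finset.card_filter_eq_sum_countP {ι κ α : Type*} [Fintype ι] [Fintype κ] {s : κ → α}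
    {f : ι → Multiset α} (h : Finset.univ.val.map s = (Finset.univ.val : Multiset ι).bind f)
    (p : α → Prop) [DecidablePred p] :
    (Finset.univ.filter fun a => p (s a)).card = ∑ i, (f i).countP p := by
  have h2 := congrArg (Multiset.countP p) h
  rw [Multiset.countP_map, Multiset.countP_eq_card_filter p, Multiset.filter_bind,
    Multiset.card_bind] at h2
  simp only [Function.comp_def, ← Multiset.countP_eq_card_filter p] at h2
  exact h2

/-- If `a + b` is an integer and `w * a` is an integer, then so is `w * b`. -/
theorem Rat.den_natCast_mul_eq_one_of_add_eq {a b : ℚ} {m : ℤ} (h : a + b = m) (w : ℕ)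
    (ha : ((w : ℚ) * a).den = 1) : ((w : ℚ) * b).den = 1 := by
  rw [Rat.den_eq_one_iff] at ha
  have : (w : ℚ) * b = ((w * m - ((w : ℚ) * a).num : ℤ) : ℚ) := by
    push_cast
    rw [ha, ← h]
    ring
  rw [this, Rat.den_intCast]

/-- The numbers `s j` and `s k` add up to `0` if `j + k = n`, and to `1` if `j + k = n + μ`. -/
theorem add_eq_of_enumeration (n : ℕ) (w : Fin (n + 1) → ℕ) (hw : ∀ i, 0 < w i)
    (s : Fin (∑ i, w i) → ℚ) (hs_mono : Monotone s)
    (hs_enum : Finset.univ.val.map s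
      = (Finset.univ.val : Multiset (Fin (n + 1))).bind
          (fun i => (Multiset.range (w i)).map fun ℓ : ℕ => (ℓ : ℚ) / (w i : ℚ)))
    (j k : Fin (∑ i, w i)) :
    ((j : ℕ) + k = n → s j + s k = 0) ∧ ((j : ℕ) + k = n + ∑ i, w i → s j + s k = 1) := by
  have hmem : ∀ a, 0 ≤ s a ∧ s a < 1 := by
    intro a
    have ha : s a ∈ Finset.univ.val.map s := Multiset.mem_map_of_mem s (Finset.mem_univ a)
    rw [hs_enum] at ha
    simp only [Multiset.mem_bind, Multiset.mem_map, Multiset.mem_range] at ha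
    obtain ⟨i, -, ℓ, hℓ, hs⟩ := ha
    have hwi : (0 : ℚ) < w i := by exact_mod_cast hw i
    rw [← hs, div_lt_one hwi]
    exact ⟨by positivity, by exact_mod_cast hℓ⟩
  have hle : ∀ x : ℚ, 0 ≤ x → x < 1 → ∀ a, s a ≤ x ↔ (a : ℕ) < ∑ i, (⌊(w i : ℚ) * x⌋₊ + 1) := by
    intro x h0 h1 a
    rw [Fin.iff_lt_card_filter_of_antitone (fun a => s a ≤ x)
        (fun b c hbc h => (hs_mono hbc).trans h) a,
      Finset.card_filter_eq_sum_countP hs_enum (· ≤ x)]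
    simp only [countP_div_le (hw _) h0 h1]
  have hlt : ∀ x : ℚ, 0 ≤ x → ∀ a, s a < 1 - x ↔ (a : ℕ) < ∑ i, (w i - ⌊(w i : ℚ) * x⌋₊) := by
    intro x h0 a
    rw [Fin.iff_lt_card_filter_of_antitone (fun a => s a < 1 - x)
        (fun b c hbc h => (hs_mono hbc).trans_lt h) a,
      Finset.card_filter_eq_sum_countP hs_enum (· < 1 - x)]
    simp only [countP_div_lt_one_sub (hw _) h0]
  have hzero : ∀ a, s a = 0 ↔ (a : ℕ) ≤ n := by
    intro a
    have h := hle 0 le_rfl one_pos a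
    simp only [mul_zero, Nat.floor_zero, zero_add, Finset.sum_const, Finset.card_univ,
      Fintype.card_fin, smul_eq_mul, mul_one, Nat.lt_succ_iff] at h
    rw [← h]
    exact ⟨le_of_eq, fun h' => le_antisymm h' (hmem a).1⟩
  constructor
  · intro h
    rw [(hzero j).mpr (by omega), (hzero k).mpr (by omega), add_zero]
  · intro h
    have key : ∀ x : ℚ, 0 ≤ x → x < 1 → (s k < 1 - x ↔ x < s j) := by
      intro x h0 h1
      have hsum : ∑ i, (⌊(w i : ℚ) * x⌋₊ + 1) + ∑ i, (w i - ⌊(w i : ℚ) * x⌋₊)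
          = ∑ i, w i + (n + 1) := by
        have : ∀ i, (⌊(w i : ℚ) * x⌋₊ + 1) + (w i - ⌊(w i : ℚ) * x⌋₊) = w i + 1 := by
          intro i
          have : ⌊(w i : ℚ) * x⌋₊ ≤ w i := Nat.floor_le_of_le
            (mul_le_of_le_one_right (Nat.cast_nonneg _) h1.le)
          omega
        rw [← Finset.sum_add_distrib, Finset.sum_congr rfl fun i _ => this i]
        simp [Finset.sum_add_distrib]
      rw [hlt x h0, ← not_le (a := s j), hle x h0 h1]
      omega
    have hk : 0 < s k := lt_of_le_of_ne (hmem k).1 fun h0 => by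
      have := (hzero k).mp h0.symm
      have := j.isLt
      omega
    have h1 := (key (s j) (hmem j).1 (hmem j).2).not.mpr (lt_irrefl _)
    have h2 := (key (1 - s k) (by linarith [(hmem k).2]) (by linarith)).not.mp (by simp)
    linarith

/-- If `j + k ≡ n (mod μ)` then `s(j) + s(k) ∈ ℤ`, the sets `I(s(j))` and
`I(s(k))` coincide, and `σ(j) + σ(k) = n`, where `σ(k) = k − μ·s(k)`. -/
theorem sigma_duality (n : ℕ) (w : Fin (n + 1) → ℕ) (hw : ∀ i, 0 < w i)
    (s : Fin (∑ i, w i) → ℚ) (hs_mono : Monotone s)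
    (hs_enum : Finset.univ.val.map s
      = (Finset.univ.val : Multiset (Fin (n + 1))).bind
          (fun i => (Multiset.range (w i)).map fun ℓ => (ℓ : ℚ) / (w i : ℚ)))
    (j k : Fin (∑ i, w i)) (hjk : ((j : ℕ) + (k : ℕ)) ≡ n [MOD ∑ i, w i]) :
    (∃ m : ℤ, s j + s k = (m : ℚ))
    ∧ (Finset.univ.filter fun i => ((w i : ℚ) * s j).den = 1)
        = (Finset.univ.filter fun i => ((w i : ℚ) * s k).den = 1)
    ∧ (((j : ℕ) : ℚ) - ((∑ i, w i : ℕ) : ℚ) * s j)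
        + (((k : ℕ) : ℚ) - ((∑ i, w i : ℕ) : ℚ) * s k) = (n : ℚ) := by
  have hj := j.isLt
  have hk := k.isLt
  have hn : n < ∑ i, w i := by
    have : ∑ _i : Fin (n + 1), 1 ≤ ∑ i, w i := Finset.sum_le_sum fun i _ => hw i
    simpa [Nat.succ_le_iff] using this
  simp only [Multiset.bind_def, Multiset.pure_def, Multiset.bind_singleton, Multiset.map_map,
    Function.comp_def] at hs_enum
  obtain ⟨h0, h1⟩ := add_eq_of_enumeration n w hw s hs_mono hs_enum j k
  have hcase : (j : ℕ) + k = n ∨ (j : ℕ) + k = n + ∑ i, w i := by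
    have hmod : ((j : ℕ) + k) % ∑ i, w i = n := Eq.trans hjk (Nat.mod_eq_of_lt hn)
    rcases lt_or_ge ((j : ℕ) + k) (∑ i, w i) with h | h
    · exact Or.inl ((Nat.mod_eq_of_lt h).symm.trans hmod)
    · rw [Nat.mod_eq_sub_mod h, Nat.mod_eq_of_lt (by omega)] at hmod
      omega
  obtain ⟨m, hm, hσ⟩ : ∃ m : ℤ, s j + s k = m ∧
      ((j : ℕ) : ℚ) + ((k : ℕ) : ℚ) = n + ((∑ i, w i : ℕ) : ℚ) * m := by
    rcases hcase with h | h
    · exact ⟨0, by simpa using h0 h, by rw [Int.cast_zero, mul_zero, add_zero]; exact_mod_cast h⟩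
    · exact ⟨1, by simpa using h1 h, by rw [Int.cast_one, mul_one]; exact_mod_cast h⟩
  refine ⟨⟨m, hm⟩, Finset.filter_congr fun i _ => ?_, ?_⟩
  · exact ⟨Rat.den_natCast_mul_eq_one_of_add_eq hm (w i),
      Rat.den_natCast_mul_eq_one_of_add_eq ((add_comm _ _).trans hm) (w i)⟩
  · rw [← hm] at hσ
    linear_combination hσ
end

section
/- The μ×μ matrix g with entries g_{j,k} := ∏_{i ∈ I(s(k))} w_i^{−1} if j + k ≡ n (mod μ) and g_{j,k} := 0 otherwise (j, k ∈ {0,…,μ−1}) is a symmetric invertible matrix; i.e. the bilinear form g(e_j, e_k) defined by this formula on ℂ^μ is symmetric and non-degenerate. -/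
/-- Two monotone enumerations of the same multiset coincide. -/
theorem Monotone.eq_of_univ_map_eq {m : ℕ} {α : Type*} [LinearOrder α] {f g : Fin m → α}
    (hf : Monotone f) (hg : Monotone g)
    (h : Finset.univ.val.map f = Finset.univ.val.map g) : f = g := by
  have hperm : (List.ofFn f).Perm (List.ofFn g) := by
    rw [Fin.univ_val_map, Fin.univ_val_map] at h
    exact Multiset.coe_eq_coe.mp h
  exact List.ofFn_injective (hperm.eq_of_pairwise' hf.sortedLE_ofFn.pairwise
    hg.sortedLE_ofFn.pairwise)

/-- The representative in `[0,1)` of `-x`, for `x ∈ [0,1)`. -/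
def negFract (x : ℚ) : ℚ := if x = 0 then 0 else 1 - x

theorem range_map_div_map_negFract {a : ℕ} (ha : 0 < a) :
    ((Multiset.range a).map fun ℓ : ℕ => (ℓ : ℚ) / (a : ℚ)).map negFract
      = (Multiset.range a).map fun ℓ : ℕ => (ℓ : ℚ) / (a : ℚ) := by
  obtain ⟨b, rfl⟩ : ∃ b, a = b + 1 := ⟨a - 1, by omega⟩
  have hb : ((b : ℚ) + 1) ≠ 0 := by positivity
  rw [Multiset.map_map]
  refine Multiset.map_eq_map_of_bij_of_nodup _ _ (Multiset.nodup_range _)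
    (Multiset.nodup_range _) (fun ℓ _ => if ℓ = 0 then 0 else b + 1 - ℓ) ?_ ?_ ?_ ?_
  · intro ℓ hℓ
    simp only [Multiset.mem_range] at *
    split_ifs <;> omega
  · intro ℓ hℓ k hk h
    simp only [Multiset.mem_range] at *
    split_ifs at h <;> omega
  · intro ℓ hℓ
    simp only [Multiset.mem_range] at *
    refine ⟨if ℓ = 0 then 0 else b + 1 - ℓ, by split_ifs <;> omega, ?_⟩
    split_ifs <;> omega
  · intro ℓ hℓ
    simp only [Multiset.mem_range] at hℓ
    by_cases h0 : ℓ = 0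
    · simp [negFract, h0]
    · have : (ℓ : ℚ) / ((b + 1 : ℕ) : ℚ) ≠ 0 := by positivity
      simp only [Function.comp_apply, negFract, this, h0, if_false]
      rw [Nat.cast_sub hℓ.le]
      push_cast
      field_simp

/-- A nonnegative monotone tuple with exactly `n + 1` zeros vanishes exactly at the indices
up to `n`. -/
theorem Monotone.eq_zero_iff_le_of_card {m n : ℕ} {s : Fin m → ℚ} (hs : Monotone s)
    (hs0 : ∀ j, 0 ≤ s j) (hcard : (Finset.univ.filter fun j => s j = 0).card = n + 1)
    (j : Fin m) : s j = 0 ↔ (j : ℕ) ≤ n := by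
  constructor
  · intro hj
    have hsub : Finset.Iic j ⊆ Finset.univ.filter fun j => s j = 0 := fun k hk => by
      simpa using le_antisymm ((hs (Finset.mem_Iic.mp hk)).trans hj.le) (hs0 k)
    have := Finset.card_le_card hsub
    rw [hcard, Fin.card_Iic] at this
    omega
  · intro hj
    by_contra h
    have hsub : (Finset.univ.filter fun j => s j = 0) ⊆ Finset.Iio j := fun k hk => by
      simp only [Finset.mem_filter, Finset.mem_univ, true_and] at hk
      rw [Finset.mem_Iio]
      by_contra hjk
      exact h (le_antisymm ((hs (not_lt.mp hjk)).trans hk.le) (hs0 j))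
    have := Finset.card_le_card hsub
    rw [hcard, Fin.card_Iio] at this
    omega

theorem card_filter_eq_zero_of_map_eq_bind {m n : ℕ} {w : Fin (n + 1) → ℕ} (hw : ∀ i, 0 < w i)
    {s : Fin m → ℚ}
    (hs_enum : Finset.univ.val.map s
      = (Finset.univ.val : Multiset (Fin (n + 1))).bind
          (fun i => (Multiset.range (w i)).map fun ℓ : ℕ => (ℓ : ℚ) / (w i : ℚ))) :
    (Finset.univ.filter fun j => s j = 0).card = n + 1 := by
  have hcount := congrArg (Multiset.count 0) hs_enum
  have hone : ∀ i, Multiset.count (0 : ℚ)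
      ((Multiset.range (w i)).map fun ℓ : ℕ => (ℓ : ℚ) / (w i : ℚ)) = 1 := fun i => by
    have hi : (w i : ℚ) ≠ 0 := by exact_mod_cast (hw i).ne'
    refine Multiset.count_eq_one_of_mem ((Multiset.nodup_range _).map fun x y h => ?_) ?_
    · simpa [div_left_inj' hi] using h
    · exact Multiset.mem_map.mpr ⟨0, by simpa using hw i, by simp⟩
  rw [Multiset.count_bind, Multiset.count_map] at hcount
  simp only [hone, Multiset.map_const', Multiset.sum_replicate, Finset.card_val,
    Finset.card_univ, Fintype.card_fin, smul_eq_mul, mul_one] at hcount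
  rw [← hcount, Finset.card_def, Finset.filter_val]
  simp only [eq_comm]

/-- The nondecreasing enumeration `s` satisfies `s (n - j) = -s j` modulo `1`. -/
theorem negFract_enumeration_sub {m n : ℕ} [NeZero m] (hnm : n < m) {w : Fin (n + 1) → ℕ}
    (hw : ∀ i, 0 < w i) {s : Fin m → ℚ} (hs_mono : Monotone s)
    (hs_enum : Finset.univ.val.map s
      = (Finset.univ.val : Multiset (Fin (n + 1))).bind
          (fun i => (Multiset.range (w i)).map fun ℓ : ℕ => (ℓ : ℚ) / (w i : ℚ))) (j : Fin m) :
    negFract (s (Fin.ofNat m n - j)) = s j := by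
  have hmem : ∀ j, 0 ≤ s j ∧ s j < 1 := fun j => by
    have hj : s j ∈ Finset.univ.val.map s := Multiset.mem_map_of_mem s (Finset.mem_univ_val j)
    rw [hs_enum] at hj
    simp only [Multiset.mem_bind, Multiset.mem_map, Multiset.mem_range] at hj
    obtain ⟨i, -, ℓ, hℓ, h⟩ := hj
    have hi : (0 : ℚ) < w i := by exact_mod_cast hw i
    rw [← h, div_lt_one hi]
    exact ⟨by positivity, by exact_mod_cast hℓ⟩
  have hzero := hs_mono.eq_zero_iff_le_of_card (fun j => (hmem j).1)
    (card_filter_eq_zero_of_map_eq_bind hw hs_enum)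
  have hval : ∀ j : Fin m, ((Fin.ofNat m n - j : Fin m) : ℕ)
      = if (j : ℕ) ≤ n then n - j else m + n - j := fun j => by
    have := j.isLt
    rw [Fin.sub_def]
    simp only [Fin.val_ofNat, Nat.mod_eq_of_lt hnm]
    split_ifs
    · rw [show m - (j : ℕ) + n = n - j + m by omega, Nat.add_mod_right, Nat.mod_eq_of_lt]
      omega
    · rw [Nat.mod_eq_of_lt] <;> omega
  have hmono : Monotone fun j => negFract (s (Fin.ofNat m n - j)) := fun j k hjk => by
    have hjk' : (j : ℕ) ≤ k := hjk
    have hj := hzero (Fin.ofNat m n - j)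
    have hk := hzero (Fin.ofNat m n - k)
    rw [hval] at hj hk
    simp only [negFract, hj, hk]
    by_cases hjn : (j : ℕ) ≤ n
    · have h := (hmem (Fin.ofNat m n - k)).2
      rw [if_pos (by rw [if_pos hjn]; omega)]
      split_ifs <;> linarith
    · have hle : s (Fin.ofNat m n - k) ≤ s (Fin.ofNat m n - j) := by
        refine hs_mono (Fin.le_def.mpr ?_)
        rw [hval, hval]
        split_ifs <;> omega
      have := j.isLt
      have := k.isLt
      rw [if_neg (by rw [if_neg hjn]; omega),
        if_neg (by rw [if_neg (by omega)]; omega)]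
      linarith
  refine congrFun (hmono.eq_of_univ_map_eq hs_mono ?_) j
  calc Finset.univ.val.map (fun j => negFract (s (Fin.ofNat m n - j)))
      = ((Finset.univ.val.map (Equiv.subLeft (Fin.ofNat m n))).map s).map negFract := by
        simp only [Multiset.map_map]; rfl
    _ = (Finset.univ.val.map s).map negFract := by rw [Multiset.map_univ_val_equiv]
    _ = Finset.univ.val.map s := by
        rw [hs_enum, Multiset.map_bind]
        simp only [range_map_div_map_negFract (hw _)]

theorem den_natCast_mul_negFract_eq_one_iff (a : ℕ) (x : ℚ) :
    ((a : ℚ) * negFract x).den = 1 ↔ ((a : ℚ) * x).den = 1 := by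
  unfold negFract
  split_ifs with h
  · rw [h]
  · rw [mul_sub, mul_one, Rat.natCast_sub_den]

/-- The `μ×μ` matrix `g` with `g_{j,k} = ∏_{i ∈ I(s(k))} wᵢ⁻¹` if
`j + k ≡ n (mod μ)` and `0` otherwise is symmetric and invertible. -/
theorem pairing_symm_invertible (n : ℕ) (w : Fin (n + 1) → ℕ) (hw : ∀ i, 0 < w i)
    (s : Fin (∑ i, w i) → ℚ) (hs_mono : Monotone s)
    (hs_enum : Finset.univ.val.map s
      = (Finset.univ.val : Multiset (Fin (n + 1))).bind
          (fun i => (Multiset.range (w i)).map fun ℓ => (ℓ : ℚ) / (w i : ℚ)))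
    (M : Matrix (Fin (∑ i, w i)) (Fin (∑ i, w i)) ℂ)
    (hM : ∀ j k : Fin (∑ i, w i), M j k =
      if ((j : ℕ) + (k : ℕ)) % (∑ i, w i) = n % (∑ i, w i) then
        ∏ i ∈ Finset.univ.filter (fun i => ((w i : ℚ) * s k).den = 1), ((w i : ℂ))⁻¹
      else 0) :
    M.IsSymm ∧ IsUnit M := by
  have hnm : n < ∑ i, w i := by
    have h : ∑ _i : Fin (n + 1), 1 ≤ ∑ i, w i := Finset.sum_le_sum fun i _ => hw i
    simp only [Finset.sum_const, Finset.card_univ, Fintype.card_fin, smul_eq_mul, mul_one] at h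
    omega
  replace hs_enum : Finset.univ.val.map s
      = (Finset.univ.val : Multiset (Fin (n + 1))).bind
          (fun i => (Multiset.range (w i)).map fun ℓ : ℕ => (ℓ : ℚ) / (w i : ℚ)) := by
    simpa only [Multiset.bind_def, Multiset.pure_def, Multiset.bind_singleton, Multiset.map_map,
      Function.comp_def] using hs_enum
  generalize ∑ i, w i = m at *
  have : NeZero m := ⟨by omega⟩
  set c : Fin m → ℂ := fun k =>
    ∏ i ∈ Finset.univ.filter (fun i => ((w i : ℚ) * s k).den = 1), ((w i : ℂ))⁻¹ with hc
  have hc_sub : ∀ k, c (Fin.ofNat m n - k) = c k := fun k => by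
    simp only [hc]
    congr 1
    ext i
    simp only [Finset.mem_filter, Finset.mem_univ, true_and]
    rw [← negFract_enumeration_sub hnm hw hs_mono hs_enum k,
      den_natCast_mul_negFract_eq_one_iff]
  have hc_ne : ∀ k, c k ≠ 0 := fun k =>
    Finset.prod_ne_zero_iff.mpr fun i _ => inv_ne_zero (by exact_mod_cast (hw i).ne')
  have hM' : ∀ j k, M j k = if Fin.ofNat m n - j = k then c k else 0 := fun j k => by
    rw [hM j k]
    refine if_congr ?_ rfl rfl
    rw [sub_eq_iff_eq_add', Fin.ext_iff, Fin.val_add, Fin.val_ofNat, eq_comm]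
  constructor
  · ext j k
    rw [Matrix.transpose_apply, hM', hM']
    by_cases h : Fin.ofNat m n - j = k
    · subst h
      rw [if_pos rfl, if_pos (sub_sub_cancel _ _), hc_sub]
    · rw [if_neg h, if_neg]
      rintro rfl
      exact h (sub_sub_cancel _ _)
  · have hsub : M = (Matrix.diagonal c).submatrix (Equiv.subLeft (Fin.ofNat m n))
        (Equiv.refl _) := by
      ext j k
      rw [hM', Matrix.submatrix_apply, Matrix.diagonal_apply]
      simp only [Equiv.subLeft_apply, Equiv.refl_apply]
      split_ifs with h
      · rw [h]
      · rfl
    rw [hsub, Matrix.isUnit_submatrix_equiv, Matrix.isUnit_diagonal, Pi.isUnit_iff]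
    exact fun k => (hc_ne k).isUnit
end
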